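/- Define D(b,c) = inf_{β,γ ∈ Γ̄} dist(b ∘ β, c ∘ γ) on AC_0([0,1],ℝ^d), where dist(b,c) = ‖R(b) − R(c)‖_{L²}. Then D is a pseudometric on AC_0([0,1],ℝ^d), D(b,c) = 0 if and only if the closures of the orbits b ∘ Γ and c ∘ Γ coincide, and the induced metric space on the quotient of AC_0 by this equivalence is a complete metric space: every sequence (c_n) in AC_0 that is Cauchy with respect to D admits a curve c ∈ AC_0 with D(c_n, c) → 0. -/

import Mathlib

open MeasureTheory Set Filter
open scoped NNReal ENNReal

noncomputable section

/-- `ℝ^d` with the Euclidean norm. -/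
abbrev E (d : ℕ) := EuclideanSpace ℝ (Fin d)

/-- `V x = x / √|x|`, with `V 0 = 0` (note `Real.sqrt 0 = 0` and `0⁻¹ = 0`). -/
def V {d : ℕ} (x : E d) : E d := (Real.sqrt ‖x‖)⁻¹ • x

/-- `c` is an absolutely continuous curve on `[0,1]` with `c 0 = 0` and a.e. derivative `f`,
i.e. `c t = ∫_0^t f` on `[0,1]` with `f` integrable. -/
def IsACDeriv {d : ℕ} (c f : ℝ → E d) : Prop :=
  StronglyMeasurable f ∧ IntegrableOn f (Icc 0 1) volume ∧
    ∀ t ∈ Icc (0:ℝ) 1, c t = ∫ τ in (0:ℝ)..t, f τ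

/-- Scalar version: `γ t = ∫_0^t g` on `[0,1]` with `g` integrable. -/
def IsACDerivR (γ g : ℝ → ℝ) : Prop :=
  StronglyMeasurable g ∧ IntegrableOn g (Icc 0 1) volume ∧
    ∀ t ∈ Icc (0:ℝ) 1, γ t = ∫ τ in (0:ℝ)..t, g τ

/-- The semigroup `Γ̄` of absolutely continuous `γ : [0,1] → [0,1]` with
`γ 0 = 0`, `γ 1 = 1` and `γ' ≥ 0` a.e. -/
def MemGammaBar (γ : ℝ → ℝ) : Prop :=
  ∃ g, IsACDerivR γ g ∧ (∀ᵐ t ∂(volume.restrict (Icc (0:ℝ) 1)), 0 ≤ g t) ∧ γ 1 = 1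

/-- The group `Γ` of absolutely continuous `γ : [0,1] → [0,1]` with
`γ 0 = 0`, `γ 1 = 1` and `γ' > 0` a.e. -/
def MemGamma (γ : ℝ → ℝ) : Prop :=
  ∃ g, IsACDerivR γ g ∧ (∀ᵐ t ∂(volume.restrict (Icc (0:ℝ) 1)), 0 < g t) ∧ γ 1 = 1

/-- The AC norm `‖x‖_{AC} = ∫_0^1 ‖x'‖` of a curve `x ∈ AC₀([0,1],ℝ^d)` (and `0` if `x` is not
such a curve); well defined since the a.e. derivative is a.e. unique. -/
def ACnorm {d : ℕ} (x : ℝ → E d) : ℝ := by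
  classical exact if h : ∃ f, IsACDeriv x f then ∫ t in (0:ℝ)..1, ‖h.choose t‖ else 0

/-- The orbit `c ∘ Γ̄` of a curve under the reparametrisation semigroup `Γ̄`
(curves are compared on `[0,1]`). -/
def OrbitBar {d : ℕ} (c : ℝ → E d) : Set (ℝ → E d) :=
  {x | ∃ γ, MemGammaBar γ ∧ ∀ t ∈ Icc (0:ℝ) 1, x t = c (γ t)}

/-- The orbit `c ∘ Γ` of a curve under the reparametrisation group `Γ`. -/
def Orbit {d : ℕ} (c : ℝ → E d) : Set (ℝ → E d) :=
  {x | ∃ γ, MemGamma γ ∧ ∀ t ∈ Icc (0:ℝ) 1, x t = c (γ t)}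

/-- The closure of a set of curves inside `AC₀([0,1],ℝ^d)` with respect to the AC norm. -/
def ACClosure {d : ℕ} (S : Set (ℝ → E d)) : Set (ℝ → E d) :=
  {x | (∃ f, IsACDeriv x f) ∧ ∀ ε > (0:ℝ), ∃ y ∈ S, ACnorm (x - y) < ε}

/-- The square root velocity distance `dist(b,c) = ‖R b - R c‖_{L²}` on `AC₀([0,1],ℝ^d)`
(and `0` if one of the arguments is not such a curve). -/
def SRVdist {d : ℕ} (b c : ℝ → E d) : ℝ := by
  classical exact
    if hb : ∃ f, IsACDeriv b f then
      if hc : ∃ f, IsACDeriv c f then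
        Real.sqrt (∫ t in (0:ℝ)..1, ‖V (hb.choose t) - V (hc.choose t)‖ ^ 2)
      else 0
    else 0

/-- The quotient distance `D(b,c) = inf_{β,γ ∈ Γ̄} dist(b ∘ β, c ∘ γ)` on shape space. -/
def QD {d : ℕ} (b c : ℝ → E d) : ℝ :=
  sInf {r : ℝ | ∃ β γ, MemGammaBar β ∧ MemGammaBar γ ∧ r = SRVdist (b ∘ β) (c ∘ γ)}

/-- Lebesgue measure on the unit interval. -/
abbrev unitVol : Measure ℝ := volume.restrict (Icc (0:ℝ) 1)

section Primitive

variable {F : Type*} [NormedAddCommGroup F] [NormedSpace ℝ F]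

/-- `c t = ∫_0^t f` on `[0,1]` with `f` integrable. -/
def IsPrimitive (c f : ℝ → F) : Prop :=
  Integrable f unitVol ∧ ∀ t ∈ Icc (0:ℝ) 1, c t = ∫ τ in (0:ℝ)..t, f τ

lemma intervalIntegral_eq_integral_indicator (f : ℝ → F) {t : ℝ} (ht : t ∈ Icc (0:ℝ) 1) :
    ∫ τ in (0:ℝ)..t, f τ = ∫ τ, (Iic t).indicator f τ ∂unitVol := by
  have h : Iic t ∩ Icc 0 1 = Icc 0 t := by
    ext x
    simp only [mem_inter_iff, mem_Iic, mem_Icc]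
    exact ⟨fun h => ⟨h.2.1, h.1⟩, fun h => ⟨h.2, h.1, h.2.trans ht.2⟩⟩
  rw [intervalIntegral.integral_of_le ht.1, integral_indicator measurableSet_Iic,
    Measure.restrict_restrict measurableSet_Iic, h, integral_Icc_eq_integral_Ioc]

lemma intervalIntegral_zero_one (f : ℝ → F) :
    ∫ τ in (0:ℝ)..1, f τ = ∫ τ, f τ ∂unitVol := by
  rw [intervalIntegral.integral_of_le zero_le_one, integral_Icc_eq_integral_Ioc]

lemma ae_mem_unitVol : ∀ᵐ t ∂unitVol, t ∈ Icc (0:ℝ) 1 :=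
  ae_restrict_mem measurableSet_Icc

lemma isPrimitive_intervalIntegral {f : ℝ → F} (hf : Integrable f unitVol) :
    IsPrimitive (fun t => ∫ τ in (0:ℝ)..t, f τ) f :=
  ⟨hf, fun _ _ => rfl⟩

namespace IsPrimitive

variable {b c f g : ℝ → F}

lemma congr (h : IsPrimitive c f) (hb : ∀ t ∈ Icc (0:ℝ) 1, b t = c t) : IsPrimitive b f :=
  ⟨h.1, fun t ht => (hb t ht).trans (h.2 t ht)⟩

lemma congr_ae (h : IsPrimitive c f) (hfg : f =ᵐ[unitVol] g) : IsPrimitive c g := by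
  refine ⟨h.1.congr hfg, fun t ht => ?_⟩
  rw [h.2 t ht, intervalIntegral_eq_integral_indicator _ ht,
    intervalIntegral_eq_integral_indicator _ ht]
  refine integral_congr_ae ?_
  filter_upwards [hfg] with x hx
  simp [indicator, hx]

lemma intervalIntegrable (h : IsPrimitive c f) {s t : ℝ} (hs : s ∈ Icc (0:ℝ) 1)
    (ht : t ∈ Icc (0:ℝ) 1) : IntervalIntegrable f volume s t := by
  have h1 : IntegrableOn f (Icc 0 1) := h.1
  exact (h1.mono_set (ordConnected_Icc.uIcc_subset hs ht)).intervalIntegrable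

lemma sub_eq (h : IsPrimitive c f) {s t : ℝ} (hs : s ∈ Icc (0:ℝ) 1)
    (ht : t ∈ Icc (0:ℝ) 1) : c t - c s = ∫ τ in s..t, f τ := by
  have h0 : (0:ℝ) ∈ Icc (0:ℝ) 1 := ⟨le_rfl, zero_le_one⟩
  rw [h.2 t ht, h.2 s hs, intervalIntegral.integral_interval_sub_left
    (h.intervalIntegrable h0 ht) (h.intervalIntegrable h0 hs)]

lemma sub (hb : IsPrimitive b f) (hc : IsPrimitive c g) : IsPrimitive (b - c) (f - g) := by
  have h0 : (0:ℝ) ∈ Icc (0:ℝ) 1 := ⟨le_rfl, zero_le_one⟩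
  refine ⟨hb.1.sub hc.1, fun t ht => ?_⟩
  simp only [Pi.sub_apply]
  rw [hb.2 t ht, hc.2 t ht, intervalIntegral.integral_sub (hb.intervalIntegrable h0 ht)
    (hc.intervalIntegrable h0 ht)]

lemma const_smul (h : IsPrimitive c f) (r : ℝ) : IsPrimitive (r • c) (r • f) := by
  refine ⟨h.1.smul r, fun t ht => ?_⟩
  simp only [Pi.smul_apply]
  rw [h.2 t ht, intervalIntegral.integral_smul]

lemma continuousOn (h : IsPrimitive c f) : ContinuousOn c (Icc 0 1) := by
  have h1 : IntegrableOn f (uIcc 0 1) := by rw [uIcc_of_le zero_le_one]; exact h.1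
  have h2 := intervalIntegral.continuousOn_primitive_interval h1
  rw [uIcc_of_le zero_le_one] at h2
  exact h2.congr h.2

lemma ae_eq [CompleteSpace F] (hf : IsPrimitive c f) (hg : IsPrimitive c g) :
    f =ᵐ[unitVol] g := by
  have h0 : (0:ℝ) ∈ Icc (0:ℝ) 1 := ⟨le_rfl, zero_le_one⟩
  have h1 : (1:ℝ) ∈ Icc (0:ℝ) 1 := ⟨zero_le_one, le_rfl⟩
  have key : ∀ {u : ℝ → F}, IsPrimitive c u →
      ∀ᵐ x, x ∈ uIcc (0:ℝ) 1 → x ∈ Ioo (0:ℝ) 1 → HasDerivAt c (u x) x := by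
    intro u hu
    filter_upwards [(hu.intervalIntegrable h0 h1).ae_hasDerivAt_integral] with x hx hx1 hx2
    refine (hx hx1 0 (by simp)).congr_of_eventuallyEq ?_
    filter_upwards [Ioo_mem_nhds hx2.1 hx2.2] with y hy
    exact hu.2 y (Ioo_subset_Icc_self hy)
  change ∀ᵐ x ∂_, f x = g x
  rw [unitVol, ← restrict_Ioo_eq_restrict_Icc, ae_restrict_iff' measurableSet_Ioo]
  filter_upwards [key hf, key hg] with x hx1 hx2 hx
  have hx' : x ∈ uIcc (0:ℝ) 1 := by rw [uIcc_of_le zero_le_one]; exact Ioo_subset_Icc_self hx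
  exact (hx1 hx' hx).unique (hx2 hx' hx)

end IsPrimitive

end Primitive

lemma IsACDeriv.isPrimitive {d : ℕ} {c f : ℝ → E d} (h : IsACDeriv c f) : IsPrimitive c f := h.2

lemma IsPrimitive.exists_isACDeriv {d : ℕ} {c f : ℝ → E d} (h : IsPrimitive c f) :
    ∃ f, IsACDeriv c f := by
  have h2 := h.congr_ae h.1.1.ae_eq_mk
  exact ⟨_, h.1.1.stronglyMeasurable_mk, h2⟩

/-- `γ` is absolutely continuous on `[0,1]` with derivative `g ≥ 0` and maps `[0,1]` onto
`[0,1]`. -/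
structure IsReparam (γ g : ℝ → ℝ) : Prop where
  isPrimitive : IsPrimitive γ g
  nonneg : ∀ᵐ t ∂unitVol, 0 ≤ g t
  map_one : γ 1 = 1

lemma memGammaBar_iff {γ : ℝ → ℝ} : MemGammaBar γ ↔ ∃ g, IsReparam γ g := by
  constructor
  · rintro ⟨g, hg, h0, h1⟩
    exact ⟨g, hg.2, h0, h1⟩
  · rintro ⟨g, hg, h0, h1⟩
    refine ⟨_, ⟨hg.1.1.stronglyMeasurable_mk, hg.congr_ae hg.1.1.ae_eq_mk⟩, ?_, h1⟩
    filter_upwards [h0, hg.1.1.ae_eq_mk] with t ht ht'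
    rwa [← ht']

lemma memGamma_iff {γ : ℝ → ℝ} : MemGamma γ ↔ ∃ g, IsReparam γ g ∧ ∀ᵐ t ∂unitVol, 0 < g t := by
  constructor
  · rintro ⟨g, hg, h0, h1⟩
    exact ⟨g, ⟨hg.2, h0.mono fun _ => le_of_lt, h1⟩, h0⟩
  · rintro ⟨g, ⟨hg, -, h1⟩, h0⟩
    refine ⟨_, ⟨hg.1.1.stronglyMeasurable_mk, hg.congr_ae hg.1.1.ae_eq_mk⟩, ?_, h1⟩
    filter_upwards [h0, hg.1.1.ae_eq_mk] with t ht ht'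
    rwa [← ht']

lemma MemGamma.memGammaBar {γ : ℝ → ℝ} (h : MemGamma γ) : MemGammaBar γ := by
  obtain ⟨g, hg, -⟩ := memGamma_iff.1 h
  exact memGammaBar_iff.2 ⟨g, hg⟩

lemma isReparam_id : IsReparam id (fun _ => 1) :=
  ⟨⟨integrable_const _, fun t _ => by simp⟩, by simp, rfl⟩

lemma memGamma_id : MemGamma id := memGamma_iff.2 ⟨_, isReparam_id, by simp⟩

namespace IsReparam

variable {γ g : ℝ → ℝ}

lemma map_zero (h : IsReparam γ g) : γ 0 = 0 := by
  simpa using h.isPrimitive.2 0 ⟨le_rfl, zero_le_one⟩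

lemma nonneg_restrict (h : IsReparam γ g) {s t : ℝ} (hs : s ∈ Icc (0:ℝ) 1)
    (ht : t ∈ Icc (0:ℝ) 1) : ∀ᵐ x ∂volume.restrict (Icc s t), 0 ≤ g x :=
  ae_restrict_of_ae_restrict_of_subset (Icc_subset_Icc hs.1 ht.2) h.nonneg

lemma monotoneOn (h : IsReparam γ g) : MonotoneOn γ (Icc 0 1) := by
  intro s hs t ht hst
  rw [← sub_nonneg, h.isPrimitive.sub_eq hs ht]
  exact intervalIntegral.integral_nonneg_of_ae_restrict hst (h.nonneg_restrict hs ht)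

lemma mapsTo (h : IsReparam γ g) : MapsTo γ (Icc 0 1) (Icc 0 1) := by
  intro t ht
  constructor
  · rw [← h.map_zero]; exact h.monotoneOn ⟨le_rfl, zero_le_one⟩ ht ht.1
  · rw [← h.map_one]; exact h.monotoneOn ht ⟨zero_le_one, le_rfl⟩ ht.2

lemma strictMonoOn (h : IsReparam γ g) (hpos : ∀ᵐ t ∂unitVol, 0 < g t) :
    StrictMonoOn γ (Icc 0 1) := by
  intro s hs t ht hst
  have hpos' : ∀ᵐ x ∂volume.restrict (Ioc s t), 0 < g x :=
    ae_restrict_of_ae_restrict_of_subset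
      (Ioc_subset_Icc_self.trans (Icc_subset_Icc hs.1 ht.2)) hpos
  rw [← sub_pos, h.isPrimitive.sub_eq hs ht,
    intervalIntegral.integral_pos_iff_support_of_nonneg_ae']
  · refine ⟨hst, ?_⟩
    have : volume (Ioc s t) ≤ volume (Function.support g ∩ Ioc s t) := by
      refine measure_mono_ae ?_
      rw [ae_restrict_iff' measurableSet_Ioc] at hpos'
      filter_upwards [hpos'] with x hx hx'
      exact ⟨(hx hx').ne', hx'⟩
    refine lt_of_lt_of_le ?_ this
    simpa using hst
  · rw [uIoc_of_le hst.le]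
    exact hpos'.mono fun _ => le_of_lt
  · exact h.isPrimitive.intervalIntegrable hs ht

lemma surjOn (h : IsReparam γ g) : SurjOn γ (Icc 0 1) (Icc 0 1) := by
  have := intermediate_value_Icc zero_le_one h.isPrimitive.continuousOn
  rwa [h.map_zero, h.map_one] at this

lemma aemeasurable (h : IsReparam γ g) : AEMeasurable γ unitVol :=
  aemeasurable_restrict_of_monotoneOn measurableSet_Icc h.monotoneOn

lemma withDensity_Icc (h : IsReparam γ g) {t : ℝ} (ht : t ∈ Icc (0:ℝ) 1) :
    unitVol.withDensity (fun x => ENNReal.ofReal (g x)) (Icc 0 t) = ENNReal.ofReal (γ t) := by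
  have hsub : Icc 0 t ⊆ Icc (0:ℝ) 1 := Icc_subset_Icc le_rfl ht.2
  rw [withDensity_apply _ measurableSet_Icc, unitVol,
    Measure.restrict_restrict measurableSet_Icc, inter_eq_left.2 hsub, h.isPrimitive.2 t ht,
    intervalIntegral.integral_of_le ht.1, ← integral_Icc_eq_integral_Ioc,
    ofReal_integral_eq_lintegral_ofReal]
  · exact IntegrableOn.mono_set h.isPrimitive.1 hsub
  · exact h.nonneg_restrict ⟨le_rfl, zero_le_one⟩ ht

lemma aemeasurable_withDensity (h : IsReparam γ g) :
    AEMeasurable γ (unitVol.withDensity fun x => ENNReal.ofReal (g x)) :=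
  h.aemeasurable.mono_ac (withDensity_absolutelyContinuous _ _)

lemma exists_preimage_Iic (h : IsReparam γ g) {a : ℝ} (ha : a ∈ Icc (0:ℝ) 1) :
    ∃ s ∈ Icc (0:ℝ) 1, γ s = a ∧ γ ⁻¹' Iic a ∩ Icc 0 1 = Icc 0 s := by
  have hcomp : IsCompact (Icc (0:ℝ) 1 ∩ γ ⁻¹' {a}) :=
    isCompact_Icc.of_isClosed_subset
      (h.isPrimitive.continuousOn.preimage_isClosed_of_isClosed isClosed_Icc isClosed_singleton)
      inter_subset_left
  obtain ⟨t, ht, hta⟩ := h.surjOn ha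
  obtain ⟨s, ⟨hs, hsa⟩, hmax⟩ := hcomp.exists_isGreatest ⟨t, ht, hta⟩
  refine ⟨s, hs, hsa, ?_⟩
  ext x
  constructor
  · rintro ⟨hxa, hx⟩
    refine ⟨hx.1, ?_⟩
    by_contra! hsx
    have : γ x = a := le_antisymm hxa (hsa ▸ h.monotoneOn hs hx hsx.le)
    exact hsx.not_ge (hmax ⟨hx, this⟩)
  · intro hx
    have hx1 : x ∈ Icc (0:ℝ) 1 := ⟨hx.1, hx.2.trans hs.2⟩
    exact ⟨(h.monotoneOn hx1 hs hx.2).trans hsa.le, hx1⟩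

/-- The push-forward of `γ' dt` under `γ` is Lebesgue measure on `[0,1]`. -/
lemma map_withDensity (h : IsReparam γ g) :
    Measure.map γ (unitVol.withDensity fun x => ENNReal.ofReal (g x)) = unitVol := by
  symm
  refine Measure.ext_of_Iic _ _ fun a => ?_
  rw [Measure.map_apply_of_aemeasurable h.aemeasurable_withDensity measurableSet_Iic]
  set ν := unitVol.withDensity fun x => ENNReal.ofReal (g x) with hν
  have hmem : ∀ᵐ t ∂ν, t ∈ Icc (0:ℝ) 1 :=
    (withDensity_absolutelyContinuous _ _).ae_le ae_mem_unitVol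
  have hinter : ν (γ ⁻¹' Iic a) = ν (γ ⁻¹' Iic a ∩ Icc 0 1) := by
    refine measure_congr ?_
    filter_upwards [hmem] with t ht
    exact propext ⟨fun h => ⟨h, ht⟩, fun h => h.1⟩
  rw [hinter, Measure.restrict_apply measurableSet_Iic]
  rcases lt_or_ge a 0 with ha | ha
  · have e1 : Iic a ∩ Icc (0:ℝ) 1 = ∅ := by
      ext x
      simp only [mem_inter_iff, mem_Iic, mem_Icc, mem_empty_iff_false, iff_false]
      intro hx; linarith
    have e2 : γ ⁻¹' Iic a ∩ Icc (0:ℝ) 1 = ∅ := by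
      ext x
      simp only [mem_inter_iff, mem_preimage, mem_Iic, mem_empty_iff_false, iff_false]
      intro hx
      have := (h.mapsTo hx.2).1
      linarith
    rw [e1, e2]; simp
  rcases lt_or_ge 1 a with ha1 | ha1
  · have e1 : Iic a ∩ Icc (0:ℝ) 1 = Icc 0 1 :=
      inter_eq_right.2 fun x hx => hx.2.trans ha1.le
    have e2 : γ ⁻¹' Iic a ∩ Icc (0:ℝ) 1 = Icc 0 1 :=
      inter_eq_right.2 fun x hx => (h.mapsTo hx).2.trans ha1.le
    rw [e1, e2, h.withDensity_Icc ⟨zero_le_one, le_rfl⟩, h.map_one]; simp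
  · have e1 : Iic a ∩ Icc (0:ℝ) 1 = Icc 0 a := by
      ext x
      simp only [mem_inter_iff, mem_Iic, mem_Icc]
      exact ⟨fun h => ⟨h.2.1, h.1⟩, fun h => ⟨h.2, h.1, h.2.trans ha1⟩⟩
    obtain ⟨s, hs, hsa, hpre⟩ := h.exists_preimage_Iic ⟨ha, ha1⟩
    rw [e1, hpre, h.withDensity_Icc hs, hsa]; simp

/-- A property holding a.e. holds a.e. along `γ`, off the critical points of `γ`. -/
lemma ae_comp (h : IsReparam γ g) {p : ℝ → Prop} (hp : ∀ᵐ s ∂unitVol, p s) :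
    ∀ᵐ t ∂unitVol, 0 < g t → p (γ t) := by
  rw [← h.map_withDensity] at hp
  have := ae_of_ae_map h.aemeasurable_withDensity hp
  rw [ae_withDensity_iff' h.isPrimitive.1.1.aemeasurable.ennreal_ofReal] at this
  filter_upwards [this] with t ht hgt
  exact ht (by simpa using hgt)

section ChangeOfVariables

variable {F : Type*} [NormedAddCommGroup F] [NormedSpace ℝ F] {f : ℝ → F}

lemma integrable_comp_iff (h : IsReparam γ g) (hf : AEStronglyMeasurable f unitVol) :
    Integrable (fun t => g t • f (γ t)) unitVol ↔ Integrable f unitVol := by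
  have hg := h.isPrimitive.1.1.aemeasurable.real_toNNReal
  have e := integrable_withDensity_iff_integrable_smul₀ hg (g := f ∘ γ)
  have hf' := hf
  rw [← h.map_withDensity] at hf'
  have e2 := integrable_map_measure hf' h.aemeasurable_withDensity
  rw [h.map_withDensity] at e2
  rw [e2]
  refine Iff.trans (integrable_congr ?_) e.symm
  filter_upwards [h.nonneg] with t ht
  simp [NNReal.smul_def, ht]

/-- Change of variables along `γ`. -/
lemma integral_comp (h : IsReparam γ g) (hf : AEStronglyMeasurable f unitVol) :
    ∫ t, g t • f (γ t) ∂unitVol = ∫ s, f s ∂unitVol := by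
  have hg := h.isPrimitive.1.1.aemeasurable.real_toNNReal
  have hf' := hf
  rw [← h.map_withDensity] at hf'
  have e1 : ∫ s, f s ∂unitVol =
      ∫ t, f (γ t) ∂unitVol.withDensity fun x => ENNReal.ofReal (g x) := by
    rw [← integral_map h.aemeasurable_withDensity hf', h.map_withDensity]
  rw [e1]
  refine Eq.trans (integral_congr_ae ?_)
    (integral_withDensity_eq_integral_smul₀ hg (fun t => f (γ t))).symm
  filter_upwards [h.nonneg] with t ht
  simp [NNReal.smul_def, ht]

end ChangeOfVariables

end IsReparam

/-- Chain rule. -/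
lemma IsPrimitive.comp {F : Type*} [NormedAddCommGroup F] [NormedSpace ℝ F] {c f : ℝ → F}
    {γ g : ℝ → ℝ} (hc : IsPrimitive c f) (h : IsReparam γ g) :
    IsPrimitive (c ∘ γ) (fun t => g t • f (γ t)) := by
  refine ⟨(h.integrable_comp_iff hc.1.1).2 hc.1, fun t ht => ?_⟩
  rw [Function.comp_apply, hc.2 _ (h.mapsTo ht),
    intervalIntegral_eq_integral_indicator _ (h.mapsTo ht),
    intervalIntegral_eq_integral_indicator _ ht,
    ← h.integral_comp (hc.1.1.indicator measurableSet_Iic)]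
  refine integral_congr_ae ?_
  have hne : ∀ᵐ s ∂unitVol, s ≠ γ t := compl_mem_ae_iff.2 (measure_singleton _)
  filter_upwards [h.ae_comp hne, h.nonneg, ae_mem_unitVol] with s hs hs0 hs1
  rcases hs0.eq_or_lt with h0 | h0
  · simp [indicator, ← h0]
  · have : γ s ∈ Iic (γ t) ↔ s ∈ Iic t := by
      simp only [mem_Iic]
      refine ⟨fun hle => ?_, fun hle => h.monotoneOn hs1 ht hle⟩
      by_contra! hlt
      exact hs h0 (le_antisymm hle (h.monotoneOn ht hs1 hlt.le))
    simp only [indicator, this]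
    split_ifs <;> simp

section SquareRootVelocity

variable {d : ℕ}

lemma norm_V (x : E d) : ‖V x‖ = √‖x‖ := by
  rw [V, norm_smul, norm_inv, Real.norm_of_nonneg (Real.sqrt_nonneg _), ← div_eq_inv_mul,
    Real.div_sqrt]

lemma norm_V_sq (x : E d) : ‖V x‖ ^ 2 = ‖x‖ := by
  rw [norm_V, Real.sq_sqrt (norm_nonneg _)]

lemma norm_V_smul_V (x : E d) : ‖V x‖ • V x = x := by
  rcases eq_or_ne x 0 with rfl | hx
  · simp [V]
  · have : √‖x‖ ≠ 0 := (Real.sqrt_pos.2 (norm_pos_iff.2 hx)).ne'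
    rw [norm_V, V, smul_smul, mul_inv_cancel₀ this, one_smul]

lemma V_norm_smul (q : E d) : V (‖q‖ • q) = q := by
  rcases eq_or_ne q 0 with rfl | hq
  · simp [V]
  · have : ‖q‖ ≠ 0 := norm_ne_zero_iff.2 hq
    rw [V, norm_smul, norm_norm, Real.sqrt_mul_self (norm_nonneg _), smul_smul,
      inv_mul_cancel₀ this, one_smul]

lemma V_smul {r : ℝ} (hr : 0 ≤ r) (x : E d) : V (r • x) = √r • V x := by
  rw [V, V, norm_smul, Real.norm_of_nonneg hr, Real.sqrt_mul hr, smul_smul, smul_smul]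
  congr 1
  rw [mul_inv, mul_right_comm, ← div_eq_inv_mul, Real.div_sqrt]

lemma measurable_V : Measurable (V : E d → E d) :=
  (measurable_norm.sqrt.inv).smul measurable_id

lemma norm_sub_sq_le_norm_smul_sub (p q : E d) :
    ‖p - q‖ ^ 2 ≤ 2 * ‖‖p‖ • p - ‖q‖ • q‖ := by
  refine abs_le_of_sq_le_sq' ?_ (by positivity) |>.2
  rw [mul_pow, norm_sub_sq_real (‖p‖ • p), norm_sub_sq_real p]
  simp only [norm_smul, norm_norm, real_inner_smul_left, real_inner_smul_right]
  have h := abs_le.1 (abs_real_inner_le_norm p q)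
  have hp := norm_nonneg p
  have hq := norm_nonneg q
  generalize inner ℝ p q = k at *
  generalize ‖p‖ = r at *
  generalize ‖q‖ = s at *
  have h1 : 0 ≤ (r * s - k) * (r * s + k) :=
    mul_nonneg (by linarith [h.2]) (by linarith [h.1])
  have h2 : 0 ≤ (r - s) ^ 2 * (3 * (r + s) ^ 2 + 4 * k) :=
    mul_nonneg (sq_nonneg _) (by nlinarith [h.1, mul_nonneg hp hq])
  nlinarith [h1, h2]

lemma norm_V_sub_sq_le (x y : E d) : ‖V x - V y‖ ^ 2 ≤ 2 * ‖x - y‖ := by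
  simpa only [norm_V_smul_V] using norm_sub_sq_le_norm_smul_sub (V x) (V y)

lemma norm_sub_le_norm_V_sub_sq (x y : E d) {η : ℝ} (hη : 0 < η) :
    ‖x - y‖ ≤ η * (‖x‖ + ‖y‖) + η⁻¹ * ‖V x - V y‖ ^ 2 := by
  have h1 : ‖x - y‖ ≤ (‖V x‖ + ‖V y‖) * ‖V x - V y‖ := by
    have e : x - y = ‖V x‖ • (V x - V y) + (‖V x‖ - ‖V y‖) • V y := by
      conv_lhs => rw [← norm_V_smul_V x, ← norm_V_smul_V y]
      module
    rw [e]
    refine (norm_add_le _ _).trans ?_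
    rw [norm_smul, norm_smul, norm_norm, Real.norm_eq_abs]
    have := abs_norm_sub_norm_le (V x) (V y)
    nlinarith [norm_nonneg (V y), norm_nonneg (V x)]
  rw [← norm_V_sq x, ← norm_V_sq y]
  refine h1.trans ?_
  have hx := norm_nonneg (V x)
  generalize ‖V x - V y‖ = b
  generalize ‖V x‖ = r
  generalize ‖V y‖ = s
  have h2 : 0 ≤ η⁻¹ * ((η * (r + s) - 2 * b) ^ 2 + η ^ 2 * (r - s) ^ 2 * 2
      + η ^ 2 * (r + s) ^ 2 ) := by positivity
  have h3 : η⁻¹ * ((η * (r + s) - 2 * b) ^ 2 + η ^ 2 * (r - s) ^ 2 * 2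
      + η ^ 2 * (r + s) ^ 2) = 4 * (η * (r ^ 2 + s ^ 2) + η⁻¹ * b ^ 2 - (r + s) * b) := by
    field_simp
    ring
  linarith

lemma MeasureTheory.Integrable.memLp_V {f : ℝ → E d} (hf : Integrable f unitVol) :
    MemLp (fun t => V (f t)) 2 unitVol := by
  have hm : AEStronglyMeasurable (fun t => V (f t)) unitVol :=
    (measurable_V.comp_aemeasurable hf.1.aemeasurable).aestronglyMeasurable
  rw [memLp_two_iff_integrable_sq_norm hm]
  simpa only [norm_V_sq] using hf.norm

/-- Absolutely continuous curves on `[0,1]` vanishing at `0`. -/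
def IsAC (c : ℝ → E d) : Prop := ∃ f, IsPrimitive c f

lemma isAC_iff {c : ℝ → E d} : IsAC c ↔ ∃ f, IsACDeriv c f :=
  ⟨fun ⟨_, hf⟩ => hf.exists_isACDeriv, fun ⟨_, hf⟩ => ⟨_, hf.isPrimitive⟩⟩

lemma IsAC.sub {b c : ℝ → E d} (hb : IsAC b) (hc : IsAC c) : IsAC (b - c) := by
  obtain ⟨f, hf⟩ := hb
  obtain ⟨g, hg⟩ := hc
  exact ⟨_, hf.sub hg⟩

lemma IsAC.comp {c : ℝ → E d} {γ : ℝ → ℝ} (hc : IsAC c) (h : MemGammaBar γ) :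
    IsAC (c ∘ γ) := by
  obtain ⟨f, hf⟩ := hc
  obtain ⟨g, hg⟩ := memGammaBar_iff.1 h
  exact ⟨_, hf.comp hg⟩

open Classical in
/-- The square root velocity transform, as an element of `L²` (zero if `c` is not absolutely
continuous). -/
def srvt (c : ℝ → E d) : Lp (E d) 2 unitVol :=
  if h : IsAC c then (h.choose_spec.1.memLp_V).toLp _ else 0

lemma IsPrimitive.coeFn_srvt {c f : ℝ → E d} (h : IsPrimitive c f) :
    srvt c =ᵐ[unitVol] fun t => V (f t) := by
  have hc : IsAC c := ⟨f, h⟩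
  rw [srvt, dif_pos hc]
  refine (MemLp.coeFn_toLp _).trans ?_
  filter_upwards [hc.choose_spec.ae_eq h] with t ht
  rw [ht]

lemma dist_srvt {b c f h : ℝ → E d} (hb : IsPrimitive b f) (hc : IsPrimitive c h) :
    dist (srvt b) (srvt c) = √(∫ t, ‖V (f t) - V (h t)‖ ^ 2 ∂unitVol) := by
  have hm := hb.1.memLp_V.sub hc.1.memLp_V
  have : eLpNorm (srvt b - srvt c : ℝ → E d) 2 unitVol =
      eLpNorm ((fun t => V (f t)) - (fun t => V (h t))) 2 unitVol :=
    eLpNorm_congr_ae (hb.coeFn_srvt.sub hc.coeFn_srvt)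
  rw [Lp.dist_def, this,
    hm.eLpNorm_eq_integral_rpow_norm (by norm_num) (by norm_num),
    ENNReal.toReal_ofReal (by positivity), Real.sqrt_eq_rpow]
  simp

lemma SRVdist_eq_dist {b c : ℝ → E d} (hb : IsAC b) (hc : IsAC c) :
    SRVdist b c = dist (srvt b) (srvt c) := by
  have hb' := isAC_iff.1 hb
  have hc' := isAC_iff.1 hc
  rw [SRVdist, dif_pos hb', dif_pos hc', intervalIntegral_zero_one,
    dist_srvt hb'.choose_spec.isPrimitive hc'.choose_spec.isPrimitive]

lemma ACnorm_eq {c f : ℝ → E d} (h : IsPrimitive c f) : ACnorm c = ∫ t, ‖f t‖ ∂unitVol := by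
  have hc := h.exists_isACDeriv
  rw [ACnorm, dif_pos hc, intervalIntegral_zero_one]
  refine integral_congr_ae ?_
  filter_upwards [hc.choose_spec.isPrimitive.ae_eq h] with t ht
  rw [ht]

lemma ACnorm_nonneg (c : ℝ → E d) : 0 ≤ ACnorm c := by
  rw [ACnorm]
  split_ifs
  · rw [intervalIntegral_zero_one]
    exact integral_nonneg fun _ => norm_nonneg _
  · exact le_rfl

lemma ACnorm_congr {b c : ℝ → E d} (hc : IsAC c) (h : ∀ t ∈ Icc (0:ℝ) 1, b t = c t) :
    ACnorm b = ACnorm c := by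
  obtain ⟨f, hf⟩ := hc
  rw [ACnorm_eq hf, ACnorm_eq (hf.congr h)]

lemma srvt_congr {b c : ℝ → E d} (hc : IsAC c) (h : ∀ t ∈ Icc (0:ℝ) 1, b t = c t) :
    srvt b = srvt c := by
  obtain ⟨f, hf⟩ := hc
  exact Lp.ext ((hf.congr h).coeFn_srvt.trans hf.coeFn_srvt.symm)

lemma ACnorm_sub_le {a b c : ℝ → E d} (ha : IsAC a) (hb : IsAC b) (hc : IsAC c) :
    ACnorm (a - c) ≤ ACnorm (a - b) + ACnorm (b - c) := by
  obtain ⟨f, hf⟩ := ha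
  obtain ⟨g, hg⟩ := hb
  obtain ⟨h, hh⟩ := hc
  rw [ACnorm_eq (hf.sub hh), ACnorm_eq (hf.sub hg), ACnorm_eq (hg.sub hh),
    ← integral_add (hf.1.sub hg.1).norm (hg.1.sub hh.1).norm]
  exact integral_mono (hf.1.sub hh.1).norm ((hf.1.sub hg.1).norm.add (hg.1.sub hh.1).norm)
    fun t => norm_sub_le_norm_sub_add_norm_sub _ _ _

lemma ACnorm_comp {c : ℝ → E d} {γ : ℝ → ℝ} (hc : IsAC c) (h : MemGammaBar γ) :
    ACnorm (c ∘ γ) = ACnorm c := by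
  obtain ⟨f, hf⟩ := hc
  obtain ⟨g, hg⟩ := memGammaBar_iff.1 h
  rw [ACnorm_eq hf, ACnorm_eq (hf.comp hg), ← hg.integral_comp hf.1.norm.1]
  refine integral_congr_ae ?_
  filter_upwards [hg.nonneg] with t ht
  rw [norm_smul, Real.norm_of_nonneg ht, smul_eq_mul]

lemma dist_srvt_comp {b c : ℝ → E d} {γ : ℝ → ℝ} (hb : IsAC b) (hc : IsAC c)
    (hγ : MemGammaBar γ) : dist (srvt (b ∘ γ)) (srvt (c ∘ γ)) = dist (srvt b) (srvt c) := by
  obtain ⟨f, hf⟩ := hb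
  obtain ⟨h, hh⟩ := hc
  obtain ⟨g, hg⟩ := memGammaBar_iff.1 hγ
  have hm : AEStronglyMeasurable (fun t => ‖V (f t) - V (h t)‖ ^ 2) unitVol :=
    (hf.1.memLp_V.sub hh.1.memLp_V).1.norm.pow 2
  rw [dist_srvt hf hh, dist_srvt (hf.comp hg) (hh.comp hg), ← hg.integral_comp hm]
  congr 1
  refine integral_congr_ae ?_
  filter_upwards [hg.nonneg] with t ht
  rw [V_smul ht, V_smul ht, ← smul_sub, norm_smul, mul_pow, Real.norm_eq_abs, sq_abs,
    Real.sq_sqrt ht, smul_eq_mul]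

lemma dist_srvt_sq_le {b c : ℝ → E d} (hb : IsAC b) (hc : IsAC c) :
    dist (srvt b) (srvt c) ^ 2 ≤ 2 * ACnorm (b - c) := by
  obtain ⟨f, hf⟩ := hb
  obtain ⟨h, hh⟩ := hc
  have hint : Integrable (fun t => ‖V (f t) - V (h t)‖ ^ 2) unitVol :=
    (hf.1.memLp_V.sub hh.1.memLp_V).norm.integrable_sq
  rw [dist_srvt hf hh, Real.sq_sqrt (integral_nonneg fun _ => by positivity),
    ACnorm_eq (hf.sub hh), ← integral_const_mul]
  exact integral_mono hint ((hf.1.sub hh.1).norm.const_mul 2) fun t => norm_V_sub_sq_le _ _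

lemma ACnorm_sub_le_dist_srvt {b c : ℝ → E d} (hb : IsAC b) (hc : IsAC c) {η : ℝ}
    (hη : 0 < η) :
    ACnorm (b - c) ≤
      η * (ACnorm b + ACnorm c) + η⁻¹ * dist (srvt b) (srvt c) ^ 2 := by
  obtain ⟨f, hf⟩ := hb
  obtain ⟨h, hh⟩ := hc
  have hint : Integrable (fun t => ‖V (f t) - V (h t)‖ ^ 2) unitVol :=
    (hf.1.memLp_V.sub hh.1.memLp_V).norm.integrable_sq
  have hsum : Integrable (fun t => η * (‖f t‖ + ‖h t‖)) unitVol :=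
    (hf.1.norm.add hh.1.norm).const_mul η
  rw [dist_srvt hf hh, Real.sq_sqrt (integral_nonneg fun _ => by positivity),
    ACnorm_eq (hf.sub hh), ACnorm_eq hf, ACnorm_eq hh, ← integral_add hf.1.norm hh.1.norm,
    ← integral_const_mul, ← integral_const_mul, ← integral_add hsum (hint.const_mul _)]
  exact integral_mono (hf.1.sub hh.1).norm (hsum.add (hint.const_mul _))
    fun t => norm_sub_le_norm_V_sub_sq _ _ hη

end SquareRootVelocity

section Reparametrisations

variable {γ κ g : ℝ → ℝ}

lemma IsReparam.integral_deriv (h : IsReparam γ g) : ∫ t, g t ∂unitVol = 1 := by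
  rw [← intervalIntegral_zero_one, ← h.isPrimitive.2 1 ⟨zero_le_one, le_rfl⟩, h.map_one]

lemma IsReparam.comp {k : ℝ → ℝ} (h : IsReparam γ g) (hκ : IsReparam κ k) :
    IsReparam (γ ∘ κ) (fun t => k t • g (κ t)) := by
  refine ⟨h.isPrimitive.comp hκ, ?_, by simp [hκ.map_one, h.map_one]⟩
  filter_upwards [hκ.nonneg, hκ.ae_comp h.nonneg] with t h0 h1
  rcases h0.eq_or_lt with h2 | h2
  · simp [← h2]
  · exact mul_nonneg h0 (h1 h2)

lemma MemGamma.comp (h : MemGamma γ) (hκ : MemGamma κ) : MemGamma (γ ∘ κ) := by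
  obtain ⟨g, hg, hg0⟩ := memGamma_iff.1 h
  obtain ⟨k, hk, hk0⟩ := memGamma_iff.1 hκ
  refine memGamma_iff.2 ⟨_, hg.comp hk, ?_⟩
  filter_upwards [hk0, hk.ae_comp hg0] with t h0 h1
  exact mul_pos h0 (h1 h0)

lemma MemGamma.exists_pos_deriv (h : MemGamma γ) :
    ∃ g, Measurable g ∧ (∀ t, 0 < g t) ∧ IsReparam γ g := by
  obtain ⟨g, hg, h0, h1⟩ := h
  have hm : Measurable g := hg.1.measurable
  have hpos : ∀ t, 0 < (if 0 < g t then g t else 1) := fun t => by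
    split_ifs with ht
    · exact ht
    · exact one_pos
  refine ⟨fun t => if 0 < g t then g t else 1,
    Measurable.ite (measurableSet_lt measurable_const hm) hm measurable_const, hpos, ?_⟩
  refine ⟨IsPrimitive.congr_ae (f := g) hg.2 ?_, ae_of_all _ fun t => (hpos t).le, h1⟩
  filter_upwards [h0] with t ht
  rw [if_pos ht]

/-- Elements of `Γ` are invertible on `[0,1]`. -/
lemma MemGamma.exists_rightInverse (h : MemGamma γ) :
    ∃ κ, MemGamma κ ∧ ∀ s ∈ Icc (0:ℝ) 1, γ (κ s) = s := by
  obtain ⟨g, hm, hpos, hg⟩ := h.exists_pos_deriv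
  have hmono := hg.strictMonoOn (ae_of_all _ hpos)
  have hex : ∀ s ∈ Icc (0:ℝ) 1, ∃ t ∈ Icc (0:ℝ) 1, γ t = s := fun s hs => hg.surjOn hs
  set κ := Function.invFunOn γ (Icc (0:ℝ) 1) with hκ
  have hκmem : ∀ s ∈ Icc (0:ℝ) 1, κ s ∈ Icc (0:ℝ) 1 := fun s hs =>
    Function.invFunOn_mem (hex s hs)
  have hκeq : ∀ s ∈ Icc (0:ℝ) 1, γ (κ s) = s := fun s hs => Function.invFunOn_eq (hex s hs)
  have hκγ : ∀ t ∈ Icc (0:ℝ) 1, κ (γ t) = t := fun t ht =>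
    hmono.injOn (hκmem _ (hg.mapsTo ht)) ht (hκeq _ (hg.mapsTo ht))
  have hκmono : MonotoneOn κ (Icc 0 1) := fun s hs t ht hst => by
    rw [← hmono.le_iff_le (hκmem s hs) (hκmem t ht), hκeq s hs, hκeq t ht]
    exact hst
  have hκm : AEMeasurable κ unitVol :=
    aemeasurable_restrict_of_monotoneOn measurableSet_Icc hκmono
  have hkm : AEStronglyMeasurable (fun s => (g (κ s))⁻¹) unitVol :=
    (hm.inv.comp_aemeasurable hκm).aestronglyMeasurable
  have hone : (fun t => g t • (g (κ (γ t)))⁻¹) =ᵐ[unitVol] fun _ => 1 := by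
    filter_upwards [ae_mem_unitVol] with t ht
    rw [hκγ t ht, smul_eq_mul, mul_inv_cancel₀ (hpos t).ne']
  have hint : Integrable (fun s => (g (κ s))⁻¹) unitVol := by
    rw [← hg.integrable_comp_iff hkm, integrable_congr hone]
    exact integrable_const _
  have hK := isPrimitive_intervalIntegral hint
  refine ⟨κ, memGamma_iff.2 ⟨_, ⟨hK.congr fun s hs => ?_, ?_, ?_⟩, ?_⟩, hκeq⟩
  · have := ((hK.comp hg).congr_ae hone).2 (κ s) (hκmem s hs)
    rw [Function.comp_apply, hκeq s hs] at this
    simpa using this.symm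
  · exact ae_of_all _ fun s => (inv_pos.2 (hpos _)).le
  · have := hκγ 1 ⟨zero_le_one, le_rfl⟩
    rwa [hg.map_one] at this
  · exact ae_of_all _ fun s => inv_pos.2 (hpos _)

/-- `γ` moved towards the identity: an element of `Γ` close to `γ`. -/
lemma IsReparam.convexComb_id (h : IsReparam γ g) {ε : ℝ} (h0 : 0 < ε) (h1 : ε < 1) :
    IsReparam (γ - ε • (γ - id)) (g - ε • (g - fun _ => 1)) ∧
      ∀ᵐ t ∂unitVol, 0 < (g - ε • (g - fun _ => 1) : ℝ → ℝ) t := by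
  have hpos : ∀ᵐ t ∂unitVol, 0 < (g - ε • (g - fun _ => 1) : ℝ → ℝ) t := by
    filter_upwards [h.nonneg] with t ht
    simp only [Pi.sub_apply, Pi.smul_apply, smul_eq_mul]
    nlinarith
  refine ⟨⟨h.isPrimitive.sub ((h.isPrimitive.sub isReparam_id.isPrimitive).const_smul ε),
    hpos.mono fun _ => le_of_lt, ?_⟩, hpos⟩
  simp [h.map_one]

end Reparametrisations

section QuotientDistance

variable {d : ℕ} {a b c : ℝ → E d} {γ : ℝ → ℝ}

/-- `b ∘ Γ` is dense in `b ∘ Γ̄`. -/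
lemma IsAC.exists_memGamma_ACnorm_lt (hb : IsAC b) (hγ : MemGammaBar γ) {η : ℝ} (hη : 0 < η) :
    ∃ κ, MemGamma κ ∧ ACnorm (b ∘ κ - b ∘ γ) < η := by
  obtain ⟨f, hf⟩ := hb
  obtain ⟨g, hg⟩ := memGammaBar_iff.1 hγ
  obtain ⟨h, hsupp, hfh, hcont, hh⟩ :=
    hf.1.exists_hasCompactSupport_integral_sub_le (show 0 < η / 6 by positivity)
  obtain ⟨M, hM⟩ := hsupp.exists_bound_of_continuous hcont
  have hM0 : 0 ≤ M := (norm_nonneg _).trans (hM 0)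
  obtain ⟨δ, hδ, hunif⟩ := Metric.uniformContinuous_iff.1
    (hsupp.uniformContinuous_of_continuous hcont) (η / 6) (by positivity)
  obtain ⟨ε, hε0, hε⟩ := exists_between
    (show 0 < min (min 1 δ) (η / (12 * (M + 1))) by positivity)
  rw [lt_min_iff, lt_min_iff, lt_div_iff₀ (by positivity)] at hε
  obtain ⟨⟨hε1, hεδ⟩, hεM⟩ := hε
  obtain ⟨hk, hkpos⟩ := hg.convexComb_id hε0 hε1
  refine ⟨_, memGamma_iff.2 ⟨_, hk, hkpos⟩, ?_⟩
  set κ := γ - ε • (γ - id) with hκ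
  set k := g - ε • (g - fun _ => 1) with hkdef
  rw [ACnorm_eq ((hf.comp hk).sub (hf.comp hg))]
  have hd : Integrable (fun s => ‖f s - h s‖) unitVol := (hf.1.sub hh).norm
  have i1 := (hk.integrable_comp_iff hd.1).2 hd
  have i2 := (hg.integrable_comp_iff hd.1).2 hd
  have i3 : Integrable (fun t => M * ε * (g t + 1)) unitVol :=
    (hg.isPrimitive.1.add (integrable_const _)).const_mul _
  have i4 : Integrable (fun t => η / 6 * g t) unitVol := hg.isPrimitive.1.const_mul _
  have i12 : Integrable (fun t => k t • ‖f (κ t) - h (κ t)‖ + g t • ‖f (γ t) - h (γ t)‖)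
      unitVol := i1.add i2
  have i123 : Integrable (fun t => k t • ‖f (κ t) - h (κ t)‖ + g t • ‖f (γ t) - h (γ t)‖
      + M * ε * (g t + 1)) unitVol := i12.add i3
  have hle : ∫ t, ‖((fun t => k t • f (κ t)) - fun t => g t • f (γ t)) t‖ ∂unitVol ≤
      ∫ t, (k t • ‖f (κ t) - h (κ t)‖ + g t • ‖f (γ t) - h (γ t)‖ + M * ε * (g t + 1)
        + η / 6 * g t) ∂unitVol := by
    refine integral_mono_ae ((hf.comp hk).sub (hf.comp hg)).1.norm
      (i123.add i4) ?_
    filter_upwards [hg.nonneg, hk.nonneg, ae_mem_unitVol] with t hg0 hk0 ht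
    have e : k t • f (κ t) - g t • f (γ t) = k t • (f (κ t) - h (κ t))
        - g t • (f (γ t) - h (γ t)) + (k t - g t) • h (κ t) + g t • (h (κ t) - h (γ t)) := by
      module
    have hγt := hg.mapsTo ht
    have hclose : ‖h (κ t) - h (γ t)‖ ≤ η / 6 := by
      rw [← dist_eq_norm]
      refine (hunif ?_).le
      have : κ t - γ t = -(ε * (γ t - t)) := by simp [hκ]
      rw [Real.dist_eq, this, abs_neg, abs_mul, abs_of_pos hε0]
      have : |γ t - t| ≤ 1 :=
        abs_sub_le_iff.2 ⟨by linarith [hγt.2, ht.1], by linarith [hγt.1, ht.2]⟩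
      nlinarith
    have hkg : |k t - g t| ≤ ε * (g t + 1) := by
      have : k t - g t = -(ε * (g t - 1)) := by simp [hkdef]
      rw [this, abs_neg, abs_mul, abs_of_pos hε0]
      gcongr
      exact abs_sub_le_iff.2 ⟨by linarith, by linarith⟩
    simp only [Pi.sub_apply]
    rw [e]
    refine (norm_add_le _ _).trans (add_le_add ((norm_add_le _ _).trans
      (add_le_add ((norm_sub_le _ _).trans (add_le_add ?_ ?_)) ?_)) ?_)
    · rw [norm_smul, Real.norm_of_nonneg hk0, smul_eq_mul]
    · rw [norm_smul, Real.norm_of_nonneg hg0, smul_eq_mul]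
    · rw [norm_smul, Real.norm_eq_abs, mul_assoc, mul_comm M]
      exact mul_le_mul hkg (hM _) (norm_nonneg _) (by positivity)
    · rw [norm_smul, Real.norm_of_nonneg hg0, mul_comm]
      exact mul_le_mul_of_nonneg_right hclose hg0
  refine hle.trans_lt ?_
  rw [integral_add i123 i4, integral_add i12 i3, integral_add i1 i2,
    hk.integral_comp hd.1, hg.integral_comp hd.1, integral_const_mul, integral_const_mul,
    integral_add hg.isPrimitive.1 (integrable_const _), hg.integral_deriv]
  simp only [integral_const, measureReal_restrict_apply_univ, Real.volume_real_Icc, sub_zero,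
    smul_eq_mul]
  norm_num
  nlinarith

lemma IsAC.exists_memGamma_dist_lt (hb : IsAC b) (hγ : MemGammaBar γ) {η : ℝ} (hη : 0 < η) :
    ∃ κ, MemGamma κ ∧ dist (srvt (b ∘ κ)) (srvt (b ∘ γ)) < η := by
  obtain ⟨κ, hκ, h⟩ := hb.exists_memGamma_ACnorm_lt hγ (show 0 < η ^ 2 / 2 by positivity)
  refine ⟨κ, hκ, lt_of_pow_lt_pow_left₀ 2 hη.le ?_⟩
  have := dist_srvt_sq_le (hb.comp hκ.memGammaBar) (hb.comp hγ)
  linarith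

lemma QD_nonneg (b c : ℝ → E d) : 0 ≤ QD b c := by
  refine Real.sInf_nonneg ?_
  rintro r ⟨β, γ, -, -, rfl⟩
  rw [SRVdist]
  split_ifs
  · exact Real.sqrt_nonneg _
  · exact le_rfl
  · exact le_rfl

lemma QD_le (hb : IsAC b) (hc : IsAC c) {β : ℝ → ℝ} (hβ : MemGammaBar β)
    (hγ : MemGammaBar γ) : QD b c ≤ dist (srvt (b ∘ β)) (srvt (c ∘ γ)) := by
  refine csInf_le ⟨0, ?_⟩ ⟨β, γ, hβ, hγ, (SRVdist_eq_dist (hb.comp hβ) (hc.comp hγ)).symm⟩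
  rintro r ⟨β, γ, hβ, hγ, rfl⟩
  rw [SRVdist_eq_dist (hb.comp hβ) (hc.comp hγ)]
  exact dist_nonneg

/-- The quotient distance may be computed by reparametrising only one of the curves, by an
element of `Γ`. -/
lemma exists_memGamma_dist_lt_of_QD_lt (hb : IsAC b) (hc : IsAC c) {r : ℝ} (h : QD b c < r) :
    ∃ γ, MemGamma γ ∧ dist (srvt b) (srvt (c ∘ γ)) < r := by
  obtain ⟨_, ⟨β, γ, hβ, hγ, rfl⟩, hlt⟩ := exists_lt_of_csInf_lt
    (by exact ⟨_, id, id, memGamma_id.memGammaBar, memGamma_id.memGammaBar, rfl⟩) h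
  rw [SRVdist_eq_dist (hb.comp hβ) (hc.comp hγ)] at hlt
  have hη : 0 < (r - dist (srvt (b ∘ β)) (srvt (c ∘ γ))) / 2 := by linarith
  obtain ⟨β', hβ', h1⟩ := hb.exists_memGamma_dist_lt hβ hη
  obtain ⟨γ', hγ', h2⟩ := hc.exists_memGamma_dist_lt hγ hη
  obtain ⟨κ, hκ, hinv⟩ := hβ'.exists_rightInverse
  refine ⟨γ' ∘ κ, hγ'.comp hκ, ?_⟩
  have e : srvt b = srvt ((b ∘ β') ∘ κ) := (srvt_congr hb fun t ht => by simp [hinv t ht]).symm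
  rw [e, ← Function.comp_assoc, dist_srvt_comp (hb.comp hβ'.memGammaBar)
    (hc.comp hγ'.memGammaBar) hκ.memGammaBar]
  have t1 := dist_triangle4 (srvt (b ∘ β')) (srvt (b ∘ β)) (srvt (c ∘ γ)) (srvt (c ∘ γ'))
  rw [dist_comm] at h2
  linarith

lemma QD_self (hb : IsAC b) : QD b b = 0 := by
  refine le_antisymm ?_ (QD_nonneg b b)
  simpa using QD_le hb hb memGamma_id.memGammaBar memGamma_id.memGammaBar

lemma QD_comm (hb : IsAC b) (hc : IsAC c) : QD b c = QD c b := by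
  suffices ∀ {b c : ℝ → E d}, IsAC b → IsAC c → QD c b ≤ QD b c from
    le_antisymm (this hc hb) (this hb hc)
  intro b c hb hc
  refine le_of_forall_gt fun r hr => ?_
  obtain ⟨γ, hγ, h⟩ := exists_memGamma_dist_lt_of_QD_lt hb hc hr
  rw [dist_comm] at h
  exact (QD_le hc hb hγ.memGammaBar memGamma_id.memGammaBar).trans_lt h

lemma QD_triangle (ha : IsAC a) (hb : IsAC b) (hc : IsAC c) :
    QD a c ≤ QD a b + QD b c := by
  refine le_of_forall_pos_le_add fun ε hε => ?_
  obtain ⟨γ, hγ, h1⟩ := exists_memGamma_dist_lt_of_QD_lt ha hb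
    (show QD a b < QD a b + ε / 2 by linarith)
  obtain ⟨κ, hκ, h2⟩ := exists_memGamma_dist_lt_of_QD_lt hb hc
    (show QD b c < QD b c + ε / 2 by linarith)
  rw [← dist_srvt_comp hb (hc.comp hκ.memGammaBar) hγ.memGammaBar] at h2
  have h3 := QD_le ha hc memGamma_id.memGammaBar (hκ.comp hγ).memGammaBar
  have h4 := dist_triangle (srvt a) (srvt (b ∘ γ)) (srvt ((c ∘ κ) ∘ γ))
  rw [Function.comp_id, ← Function.comp_assoc] at h3
  linarith

lemma QD_eq_zero_of_ACClosure_eq (hb : IsAC b) (hc : IsAC c)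
    (h : ACClosure (Orbit b) = ACClosure (Orbit c)) : QD b c = 0 := by
  refine le_antisymm (le_of_forall_pos_le_add fun ε hε => ?_) (QD_nonneg b c)
  have hmem : b ∈ ACClosure (Orbit b) := by
    refine ⟨isAC_iff.1 hb, fun ε hε => ⟨b, ⟨id, memGamma_id, fun _ _ => rfl⟩, ?_⟩⟩
    obtain ⟨f, hf⟩ := hb
    rw [ACnorm_eq (hf.sub hf)]
    simpa using hε
  rw [h] at hmem
  obtain ⟨y, ⟨γ, hγ, hy⟩, hlt⟩ := hmem.2 (ε ^ 2 / 2) (by positivity)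
  have hcγ := hc.comp hγ.memGammaBar
  have hsub : ACnorm (b - y) = ACnorm (b - c ∘ γ) :=
    ACnorm_congr (hb.sub hcγ) fun t ht => by simp [hy t ht]
  have h1 := dist_srvt_sq_le hb hcγ
  have h2 : dist (srvt b) (srvt (c ∘ γ)) < ε :=
    lt_of_pow_lt_pow_left₀ 2 hε.le (by linarith)
  have h3 := QD_le hb hc memGamma_id.memGammaBar hγ.memGammaBar
  rw [Function.comp_id] at h3
  linarith

lemma exists_memGamma_ACnorm_sub_lt_of_QD_eq_zero (hb : IsAC b) (hc : IsAC c)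
    (h : QD b c = 0) {ε : ℝ} (hε : 0 < ε) : ∃ γ, MemGamma γ ∧ ACnorm (b - c ∘ γ) < ε := by
  have hL : 0 ≤ ACnorm b + ACnorm c := add_nonneg (ACnorm_nonneg b) (ACnorm_nonneg c)
  set L := ACnorm b + ACnorm c with hLdef
  set η := ε / (2 * (L + 1)) with hη
  have hη0 : 0 < η := by positivity
  obtain ⟨γ, hγ, hlt⟩ := exists_memGamma_dist_lt_of_QD_lt hb hc
    (show QD b c < √(η * (ε / 2)) by rw [h]; positivity)
  refine ⟨γ, hγ, ?_⟩
  have h1 := ACnorm_sub_le_dist_srvt hb (hc.comp hγ.memGammaBar) hη0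
  rw [ACnorm_comp hc hγ.memGammaBar, ← hLdef] at h1
  have h2 : dist (srvt b) (srvt (c ∘ γ)) ^ 2 < η * (ε / 2) :=
    (Real.lt_sqrt dist_nonneg).1 hlt
  have h3 : η⁻¹ * dist (srvt b) (srvt (c ∘ γ)) ^ 2 < ε / 2 := by
    rwa [inv_mul_lt_iff₀ hη0]
  have h4 : η * L ≤ ε / 2 := by
    have : η * (L + 1) = ε / 2 := by rw [hη]; field_simp
    nlinarith
  linarith

lemma ACClosure_orbit_subset_of_QD_eq_zero (hb : IsAC b) (hc : IsAC c) (h : QD b c = 0) :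
    ACClosure (Orbit b) ⊆ ACClosure (Orbit c) := by
  rintro x ⟨hx, hxb⟩
  refine ⟨hx, fun ε hε => ?_⟩
  have hx := isAC_iff.2 hx
  obtain ⟨y, ⟨κ, hκ, hy⟩, hlt⟩ := hxb (ε / 2) (by positivity)
  obtain ⟨γ, hγ, hlt'⟩ := exists_memGamma_ACnorm_sub_lt_of_QD_eq_zero hb hc h
    (show 0 < ε / 2 by positivity)
  refine ⟨c ∘ (γ ∘ κ), ⟨_, hγ.comp hκ, fun _ _ => rfl⟩, ?_⟩
  have hbκ := hb.comp hκ.memGammaBar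
  have hcγ := hc.comp hγ.memGammaBar
  have e1 : ACnorm (x - y) = ACnorm (x - b ∘ κ) :=
    ACnorm_congr (hx.sub hbκ) fun t ht => by simp [hy t ht]
  have e2 : ACnorm (b ∘ κ - (c ∘ γ) ∘ κ) = ACnorm (b - c ∘ γ) :=
    ACnorm_comp (hb.sub hcγ) hκ.memGammaBar
  have h3 := ACnorm_sub_le hx hbκ (hcγ.comp hκ.memGammaBar)
  rw [← Function.comp_assoc]
  linarith

lemma QD_eq_zero_iff (hb : IsAC b) (hc : IsAC c) :
    QD b c = 0 ↔ ACClosure (Orbit b) = ACClosure (Orbit c) :=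
  ⟨fun h => (ACClosure_orbit_subset_of_QD_eq_zero hb hc h).antisymm
    (ACClosure_orbit_subset_of_QD_eq_zero hc hb (QD_comm hb hc ▸ h)),
    QD_eq_zero_of_ACClosure_eq hb hc⟩

/-- The square root velocity transform is surjective. -/
lemma exists_isAC_srvt_eq (q : Lp (E d) 2 unitVol) : ∃ c, IsAC c ∧ srvt c = q := by
  have hq := Lp.memLp q
  have hint : Integrable (fun t => ‖q t‖ • q t) unitVol := by
    refine (integrable_norm_iff (hq.1.norm.smul hq.1)).1 ?_
    refine hq.norm.integrable_sq.congr (ae_of_all _ fun t => ?_)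
    simp [norm_smul, sq]
  have hc := isPrimitive_intervalIntegral hint
  refine ⟨_, ⟨_, hc⟩, Lp.ext (hc.coeFn_srvt.trans (ae_of_all _ fun t => ?_))⟩
  exact V_norm_smul _

/-- A sequence of curves with summable consecutive quotient distances converges. -/
lemma exists_tendsto_QD_of_le_geometric {x : ℕ → ℝ → E d} (hx : ∀ n, IsAC (x n))
    (h : ∀ n, QD (x n) (x (n + 1)) < (1 / 2) ^ n) :
    ∃ c, IsAC c ∧ Tendsto (fun n => QD (x n) c) atTop (nhds 0) := by
  choose δ hδ hdist using fun n => exists_memGamma_dist_lt_of_QD_lt (hx n) (hx (n + 1)) (h n)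
  let γ : ℕ → ℝ → ℝ := fun n => Nat.rec id (fun n γn => δ n ∘ γn) n
  have hsucc : ∀ n, γ (n + 1) = δ n ∘ γ n := fun n => rfl
  have hγ : ∀ n, MemGamma (γ n) := by
    intro n
    induction n with
    | zero => exact memGamma_id
    | succ n ih => rw [hsucc]; exact (hδ n).comp ih
  have hcauchy : CauchySeq fun n => srvt (x n ∘ γ n) := by
    refine cauchySeq_of_le_geometric (1 / 2) 1 (by norm_num) fun n => ?_
    rw [hsucc, ← Function.comp_assoc, dist_srvt_comp (hx n)
      ((hx (n + 1)).comp (hδ n).memGammaBar) (hγ n).memGammaBar, one_mul]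
    exact (hdist n).le
  obtain ⟨q, hq⟩ := cauchySeq_tendsto_of_complete hcauchy
  obtain ⟨c, hc, rfl⟩ := exists_isAC_srvt_eq q
  refine ⟨c, hc, squeeze_zero (fun n => QD_nonneg _ _) (fun n => ?_)
    (tendsto_iff_dist_tendsto_zero.1 hq)⟩
  have := QD_le (hx n) hc (hγ n).memGammaBar memGamma_id.memGammaBar
  rwa [Function.comp_id] at this

lemma exists_tendsto_QD_of_cauchy {x : ℕ → ℝ → E d} (hx : ∀ n, IsAC (x n))
    (h : ∀ ε > (0:ℝ), ∃ N, ∀ m ≥ N, ∀ n ≥ N, QD (x m) (x n) < ε) :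
    ∃ c, IsAC c ∧ Tendsto (fun n => QD (x n) c) atTop (nhds 0) := by
  obtain ⟨φ, hφ, hφlt⟩ := extraction_forall_of_eventually'
    (P := fun k m => ∀ n ≥ m, QD (x m) (x n) < (1 / 2) ^ k) fun k => by
      obtain ⟨N, hN⟩ := h ((1 / 2) ^ k) (by positivity)
      exact ⟨N, fun m hm n hn => hN m hm n (hm.trans hn)⟩
  obtain ⟨c, hc, hlim⟩ := exists_tendsto_QD_of_le_geometric (fun k => hx (φ k))
    fun k => hφlt k _ (hφ (Nat.lt_succ_self k)).le
  refine ⟨c, hc, tendsto_order.2 ⟨fun r hr => .of_forall fun n => hr.trans_le (QD_nonneg _ _),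
    fun r hr => ?_⟩⟩
  obtain ⟨N, hN⟩ := h (r / 2) (by positivity)
  obtain ⟨k, hk, hkN⟩ := ((hlim.eventually_lt_const (show 0 < r / 2 by positivity)).and
    (hφ.tendsto_atTop.eventually_ge_atTop N)).exists
  filter_upwards [eventually_ge_atTop N] with n hn
  have h1 := QD_triangle (hx n) (hx (φ k)) hc
  have h2 := hN n hn (φ k) hkN
  linarith

end QuotientDistance

/-- `D(b,c) = inf_{β,γ ∈ Γ̄} dist(b∘β, c∘γ)` is a pseudometric on
`AC₀([0,1],ℝ^d)`; `D(b,c) = 0` iff the AC closures of the orbits `b ∘ Γ` and `c ∘ Γ` coincide;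
and the induced metric space on the quotient is complete: every `D`-Cauchy sequence in `AC₀`
admits a curve `c ∈ AC₀` with `D(cₙ, c) → 0`. -/
theorem stmt_15 (d : ℕ) :
    -- pseudometric: nonnegativity, vanishing on the diagonal, symmetry, triangle inequality
    (∀ b c : ℝ → E d, (∃ f, IsACDeriv b f) → (∃ f, IsACDeriv c f) →
      0 ≤ QD b c ∧ QD b b = 0 ∧ QD b c = QD c b) ∧
    (∀ a b c : ℝ → E d, (∃ f, IsACDeriv a f) → (∃ f, IsACDeriv b f) → (∃ f, IsACDeriv c f) →
      QD a c ≤ QD a b + QD b c) ∧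
    -- D(b,c) = 0 iff the orbit closures coincide
    (∀ (b c : ℝ → E d) (fb fc : ℝ → E d), IsACDeriv b fb → IsACDeriv c fc →
      (QD b c = 0 ↔ ACClosure (Orbit b) = ACClosure (Orbit c))) ∧
    -- completeness of the quotient
    (∀ cs : ℕ → ℝ → E d, (∀ n, ∃ f, IsACDeriv (cs n) f) →
      (∀ ε > (0:ℝ), ∃ N, ∀ m ≥ N, ∀ n ≥ N, QD (cs m) (cs n) < ε) →
      ∃ c : ℝ → E d, (∃ f, IsACDeriv c f) ∧
        Tendsto (fun n => QD (cs n) c) atTop (nhds 0)) := by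
  simp only [← isAC_iff]
  exact ⟨fun b c hb hc => ⟨QD_nonneg b c, QD_self hb, QD_comm hb hc⟩,
    fun a b c => QD_triangle,
    fun b c fb fc hb hc => QD_eq_zero_iff ⟨fb, hb.isPrimitive⟩ ⟨fc, hc.isPrimitive⟩,
    fun cs => exists_tendsto_QD_of_cauchy⟩
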